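/- The 3-sphere (11⁰₃₅) with facet list F0={1,2,4,6,9}, F1={3,5,7,8,9}, F2={0,6,7,8,10}, F3={2,3,4,8,9}, F4={0,1,2,5,6,10}, F5={3,4,7,8,10}, F6={1,5,6,7,9}, F7={0,1,2,4,8,10}, F8={3,5,6,7,10}, F9={0,2,6,7,8,9}, F10={1,3,4,5,9,10} (subsets of Fin 11) has no polytopal realization; i.e., there is no injective v : Fin 11 → ℝ⁴ such that every v j is an extreme point of P = convexHull ℝ (Set.range v) and the set of facets (3-dimensional proper faces) of P equals { convexHull ℝ (v '' F_i) : 0 ≤ i ≤ 10 }. -/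

import Mathlib

open Module

/-- The facet list of the 3-sphere `(11⁰₃₅)`. -/
def facets : Fin 11 → Set (Fin 11) :=
  ![{1,2,4,6,9}, {3,5,7,8,9}, {0,6,7,8,10}, {2,3,4,8,9}, {0,1,2,5,6,10},
    {3,4,7,8,10}, {1,5,6,7,9}, {0,1,2,4,8,10}, {3,5,6,7,10}, {0,2,6,7,8,9},
    {1,3,4,5,9,10}]

set_option maxHeartbeats 1000000

open Matrix in
/-- The determinant of five vectors, scaled by `k`. -/
noncomputable def brk (k : ℝ) (x : Fin 11 → Fin 5 → ℝ) (a b c d e : Fin 11) : ℝ :=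
  k * Matrix.det (Matrix.of ![x a, x b, x c, x d, x e])

/-- Finset version of the facet list. -/
def FF : Fin 11 → Finset (Fin 11) :=
  ![{1,2,4,6,9}, {3,5,7,8,9}, {0,6,7,8,10}, {2,3,4,8,9}, {0,1,2,5,6,10},
    {3,4,7,8,10}, {1,5,6,7,9}, {0,1,2,4,8,10}, {3,5,6,7,10}, {0,2,6,7,8,9},
    {1,3,4,5,9,10}]

theorem mem_FF (i j : Fin 11) : j ∈ facets i ↔ j ∈ FF i := by
  fin_cases i <;> simp [facets, FF]

theorem brk_perm (k : ℝ) (x : Fin 11 → Fin 5 → ℝ) (i j : Fin 5) (hij : i ≠ j)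
    (f g : Fin 5 → Fin 11) (h : g = f ∘ Equiv.swap i j) :
    brk k x (f 0) (f 1) (f 2) (f 3) (f 4) = - brk k x (g 0) (g 1) (g 2) (g 3) (g 4) := by
  have e : ∀ f : Fin 5 → Fin 11, Matrix.of ![x (f 0), x (f 1), x (f 2), x (f 3), x (f 4)]
      = Matrix.of (fun a => x (f a)) := by
    intro f; ext a b; fin_cases a <;> rfl
  unfold brk
  rw [e, e]
  have := Matrix.det_permute (Equiv.swap i j) (Matrix.of (fun a => x (f a)))
  have h2 : (Matrix.of (fun a => x (f a))).submatrix (Equiv.swap i j) id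
      = Matrix.of (fun a => x (g a)) := by subst h; rfl
  rw [h2, Equiv.Perm.sign_swap hij] at this
  rw [this]; simp

/-- The determinant is linear in its last row. -/
theorem brk_lin (k : ℝ) (x : Fin 11 → Fin 5 → ℝ) (a b c d : Fin 11) :
    ∃ C : Fin 5 → ℝ, ∀ e, brk k x a b c d e = ∑ m, C m * x e m := by
  let M := Matrix.of ![x a, x b, x c, x d, 0]
  refine ⟨fun m => k * Matrix.cramer M.transpose (fun j => if m = j then 1 else 0) 4,
    fun e => ?_⟩
  have h : Matrix.of ![x a, x b, x c, x d, x e] = M.updateRow 4 (x e) := by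
    ext p q; fin_cases p <;> simp [M, Matrix.updateRow_apply]
  unfold brk
  rw [h, ← Matrix.cramer_transpose_apply,
    LinearMap.pi_apply_eq_sum_univ (Matrix.cramer M.transpose) (x e), Finset.sum_apply,
    Finset.mul_sum]
  refine Finset.sum_congr rfl fun m _ => ?_
  rw [Pi.smul_apply, smul_eq_mul]
  ring

/-- Cramer's relation for six vectors in dimension five. -/
theorem brk_cramer (k : ℝ) (x : Fin 11 → Fin 5 → ℝ) (a b c d e f : Fin 11) (m : Fin 5) :
    x a m * brk k x b c d e f - x b m * brk k x a c d e f + x c m * brk k x a b d e f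
    - x d m * brk k x a b c e f + x e m * brk k x a b c d f - x f m * brk k x a b c d e = 0 := by
  let w : Fin 6 → Fin 5 → ℝ := ![x a, x b, x c, x d, x e, x f]
  let N : Matrix (Fin 6) (Fin 6) ℝ := Matrix.of fun i => Fin.cons (w i m) (w i)
  have hN : N.det = 0 := by
    apply Matrix.det_zero_of_column_eq (i := 0) (j := m.succ) (Fin.succ_ne_zero m).symm
    intro i; simp [N]
  rw [Matrix.det_succ_column_zero] at hN
  have hs : ∀ i : Fin 6, N.submatrix i.succAbove Fin.succ = Matrix.of (fun p => w (i.succAbove p)) := by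
    intro i; ext p q; simp [N]
  have e : ∀ g : Fin 5 → Fin 5 → ℝ, Matrix.of ![g 0, g 1, g 2, g 3, g 4] = Matrix.of g := by
    intro f; ext a b; fin_cases a <;> rfl
  simp only [hs] at hN
  have e2 : ∀ i : Fin 6, Matrix.det (Matrix.of (fun p => w (i.succAbove p))) = Matrix.det
      (Matrix.of ![w (i.succAbove 0), w (i.succAbove 1), w (i.succAbove 2), w (i.succAbove 3),
        w (i.succAbove 4)]) := fun i => by rw [← e (fun p => w (i.succAbove p))]
  simp only [e2] at hN
  have h0 : ∀ i, N i 0 = w i m := fun i => rfl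
  simp only [h0, Fin.sum_univ_six] at hN
  unfold brk
  have hk := congrArg (fun t => k * t) hN
  simp only [mul_zero] at hk
  rw [← hk]
  simp [w, Fin.succAbove, Fin.lt_def]
  ring

theorem brk_zero4 (k : ℝ) (x : Fin 11 → Fin 5 → ℝ) (a b c d e : Fin 11)
    (h : a = e ∨ b = e ∨ c = e) : brk k x a b c d e = 0 := by
  unfold brk
  rcases h with rfl | rfl | rfl
  · rw [Matrix.det_zero_of_row_eq (i := 0) (j := 4) (by decide) rfl, mul_zero]
  · rw [Matrix.det_zero_of_row_eq (i := 1) (j := 4) (by decide) rfl, mul_zero]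
  · rw [Matrix.det_zero_of_row_eq (i := 2) (j := 4) (by decide) rfl, mul_zero]

/-- Three-term Grassmann-Plücker relation. -/
theorem brk_gp (k : ℝ) (x : Fin 11 → Fin 5 → ℝ) (r s t a b c d : Fin 11) :
    brk k x r s t a b * brk k x r s t c d - brk k x r s t a c * brk k x r s t b d
    + brk k x r s t a d * brk k x r s t b c = 0 := by
  obtain ⟨C, hC⟩ := brk_lin k x r s t a
  have z1 := brk_zero4 k x r s t a r (by simp)
  have z2 := brk_zero4 k x r s t a s (by simp)
  have z3 := brk_zero4 k x r s t a t (by simp)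
  rw [hC] at z1 z2 z3
  rw [hC b, hC c, hC d]
  have cr := fun m => brk_cramer k x r s t b c d m
  simp only [Fin.sum_univ_five] at *
  linear_combination (-1 : ℝ) * (C 0 * cr 0 + C 1 * cr 1 + C 2 * cr 2 + C 3 * cr 3 + C 4 * cr 4)
    + brk k x s t b c d * z1 - brk k x r t b c d * z2 + brk k x r s b c d * z3

open Matrix in
theorem key (x φ : Fin 11 → Fin 5 → ℝ) (h0 : ∀ i j, j ∈ FF i → x j ⬝ᵥ φ i = 0)
    (h1 : ∀ i j, j ∉ FF i → 0 < x j ⬝ᵥ φ i) : False := by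
  have hdet : Matrix.det (Matrix.of ![x 0, x 3, x 7, x 8, x 9]) ≠ 0 := by
    intro hd
    obtain ⟨c, hc, hc0⟩ := Matrix.exists_vecMul_eq_zero_iff.2 hd
    have key : ∀ i, c 0 * (x 0 ⬝ᵥ φ i) + c 1 * (x 3 ⬝ᵥ φ i) + c 2 * (x 7 ⬝ᵥ φ i)
        + c 3 * (x 8 ⬝ᵥ φ i) + c 4 * (x 9 ⬝ᵥ φ i) = 0 := by
      intro i
      have := congrArg (fun t => t ⬝ᵥ φ i) hc0
      simp only [← Matrix.dotProduct_mulVec, zero_dotProduct] at this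
      rw [← this]
      simp [dotProduct, Matrix.mulVec, Fin.sum_univ_five]
    have k1 := key 1
    have k5 := key 5
    have k8 := key 8
    have k9 := key 9
    have k3 := key 3
    simp only [h0 1 3 (by decide), h0 1 7 (by decide), h0 1 8 (by decide), h0 1 9 (by decide),
      h0 5 3 (by decide), h0 5 7 (by decide), h0 5 8 (by decide), h0 8 3 (by decide),
      h0 8 7 (by decide), h0 9 0 (by decide), h0 9 7 (by decide), h0 9 8 (by decide),
      h0 9 9 (by decide), h0 3 3 (by decide), h0 3 8 (by decide), h0 3 9 (by decide),
      mul_zero, add_zero, zero_add] at k1 k5 k8 k9 k3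
    have c0 : c 0 = 0 := (mul_eq_zero.1 k1).resolve_right (h1 1 0 (by decide)).ne'
    have c1 : c 1 = 0 := (mul_eq_zero.1 k9).resolve_right (h1 9 3 (by decide)).ne'
    rw [c0, zero_mul, zero_add] at k5 k3 k8
    have c4 : c 4 = 0 := (mul_eq_zero.1 k5).resolve_right (h1 5 9 (by decide)).ne'
    have c2 : c 2 = 0 := (mul_eq_zero.1 k3).resolve_right (h1 3 7 (by decide)).ne'
    rw [c4, zero_mul, add_zero] at k8
    have c3 : c 3 = 0 := (mul_eq_zero.1 k8).resolve_right (h1 8 8 (by decide)).ne'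
    apply hc
    ext i
    fin_cases i <;> assumption
  obtain ⟨k, hk⟩ : ∃ k : ℝ, k = Matrix.det (Matrix.of ![x 0, x 3, x 7, x 8, x 9]) := ⟨_, rfl⟩
  obtain ⟨D, hD⟩ : ∃ D, D = brk k x := ⟨_, rfl⟩
  have h03789 : 0 < D 0 3 7 8 9 := by
    rw [hD]; unfold brk; rw [← hk]; exact mul_self_pos.2 (hk ▸ hdet)
  have s1 : ∀ a b c d e, D a b c d e = - D b a c d e := fun a b c d e =>
    hD ▸ brk_perm k x 0 1 (by decide) ![a, b, c, d, e] ![b, a, c, d, e] (by ext i; fin_cases i <;> rfl)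
  have s2 : ∀ a b c d e, D a b c d e = - D a c b d e := fun a b c d e =>
    hD ▸ brk_perm k x 1 2 (by decide) ![a, b, c, d, e] ![a, c, b, d, e] (by ext i; fin_cases i <;> rfl)
  have s3 : ∀ a b c d e, D a b c d e = - D a b d c e := fun a b c d e =>
    hD ▸ brk_perm k x 2 3 (by decide) ![a, b, c, d, e] ![a, b, d, c, e] (by ext i; fin_cases i <;> rfl)
  have s4 : ∀ a b c d e, D a b c d e = - D a b c e d := fun a b c d e =>
    hD ▸ brk_perm k x 3 4 (by decide) ![a, b, c, d, e] ![a, b, c, e, d] (by ext i; fin_cases i <;> rfl)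
  have gp : ∀ r s t a b c d, D r s t a b * D r s t c d - D r s t a c * D r s t b d
      + D r s t a d * D r s t b c = 0 := hD ▸ brk_gp k x
  have dz : ∀ (i : Fin 11) (M : Matrix (Fin 5) (Fin 5) ℝ), M *ᵥ φ i = 0 → M.det = 0 := by
    intro i M hM
    refine Matrix.exists_mulVec_eq_zero_iff.1 ⟨φ i, ?_, hM⟩
    intro hz
    have : ∃ j, j ∉ FF i := by clear hM hz M; revert i; decide
    obtain ⟨j, hj⟩ := this
    have := h1 i j hj
    rw [hz] at this
    simp at this
  have ez : ∀ i a b c d e, (a ∈ FF i ∧ b ∈ FF i ∧ c ∈ FF i ∧ d ∈ FF i ∧ e ∈ FF i) →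
      D a b c d e = 0 := by
    rintro i a b c d e ⟨ha, hb, hc, hd, he⟩
    rw [hD]; unfold brk
    rw [dz i, mul_zero]
    ext p
    fin_cases p
    · exact h0 i a ha
    · exact h0 i b hb
    · exact h0 i c hc
    · exact h0 i d hd
    · exact h0 i e he
  have eq : ∀ i a b c d y z, (a ∈ FF i ∧ b ∈ FF i ∧ c ∈ FF i ∧ d ∈ FF i) →
      D a b c d y * (x z ⬝ᵥ φ i) = D a b c d z * (x y ⬝ᵥ φ i) := by
    rintro i a b c d y z ⟨ha, hb, hc, hd⟩
    rw [hD]; unfold brk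
    let M := Matrix.of ![x a, x b, x c, x d, 0]
    have e : ∀ u, Matrix.of ![x a, x b, x c, x d, u] = M.updateRow 4 u := by
      intro u; ext p q; fin_cases p <;> simp [M, Matrix.updateRow_apply]
    have hz : (M.updateRow 4 ((x z ⬝ᵥ φ i) • x y + (-(x y ⬝ᵥ φ i)) • x z)).det = 0 := by
      apply dz i
      rw [← e]
      ext p
      fin_cases p
      · exact h0 i a ha
      · exact h0 i b hb
      · exact h0 i c hc
      · exact h0 i d hd
      · show ((x z ⬝ᵥ φ i) • x y + (-(x y ⬝ᵥ φ i)) • x z) ⬝ᵥ φ i = 0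
        rw [add_dotProduct, smul_dotProduct, smul_dotProduct]
        simp only [smul_eq_mul]; ring
    rw [Matrix.det_updateRow_add, Matrix.det_updateRow_smul, Matrix.det_updateRow_smul] at hz
    rw [e, e]
    linear_combination k * hz
  have ep : ∀ i a b c d y z, ((a ∈ FF i ∧ b ∈ FF i ∧ c ∈ FF i ∧ d ∈ FF i) ∧ y ∉ FF i ∧ z ∉ FF i) →
      0 < D a b c d y → 0 < D a b c d z := by
    rintro i a b c d y z ⟨h, hy, hz⟩ hp
    exact pos_of_mul_pos_left ((eq i a b c d y z h) ▸ mul_pos hp (h1 i z hz)) (h1 i y hy).le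
  have en : ∀ i a b c d y z, ((a ∈ FF i ∧ b ∈ FF i ∧ c ∈ FF i ∧ d ∈ FF i) ∧ y ∉ FF i ∧ z ∉ FF i) →
      D a b c d y < 0 → D a b c d z < 0 := by
    rintro i a b c d y z ⟨h, hy, hz⟩ hp
    have := eq i a b c d y z h
    have h2 := mul_neg_of_neg_of_pos hp (h1 i z hz)
    rw [this] at h2
    exact neg_of_mul_neg_left h2 (h1 i y hy).le
  have ee : ∀ i a b c d y z, ((a ∈ FF i ∧ b ∈ FF i ∧ c ∈ FF i ∧ d ∈ FF i) ∧ y ∉ FF i ∧ z ∉ FF i) →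
      D a b c d z = 0 → D a b c d y = 0 := by
    rintro i a b c d y z ⟨h, hy, hz⟩ hp
    have := eq i a b c d y z h
    rw [hp, zero_mul] at this
    exact (mul_eq_zero.1 this).resolve_right (h1 i z hz).ne'
  clear hD
  have h34789 : D 3 4 7 8 9 < 0 := by
    have h := ep 1 3 7 8 9 0 4 (by decide) (by linarith [s4 3 7 8 9 0, s3 3 7 8 0 9, s2 3 7 0 8 9, s1 3 0 7 8 9, h03789])
    linarith [s4 3 7 8 9 4, s3 3 7 8 4 9, s2 3 7 4 8 9, h]
  have h36789 : D 3 6 7 8 9 < 0 := by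
    have h := ep 1 3 7 8 9 0 6 (by decide) (by linarith [s4 3 7 8 9 0, s3 3 7 8 0 9, s2 3 7 0 8 9, s1 3 0 7 8 9, h03789])
    linarith [s4 3 7 8 9 6, s3 3 7 8 6 9, s2 3 7 6 8 9, h]
  have h23789 : 0 < D 2 3 7 8 9 := by
    have h := ep 1 3 7 8 9 6 2 (by decide) (by linarith [s4 3 7 8 9 6, s3 3 7 8 6 9, s2 3 7 6 8 9, h36789])
    linarith [s4 3 7 8 9 2, s3 3 7 8 2 9, s2 3 7 2 8 9, s1 3 2 7 8 9, h]
  have h16789 : D 1 6 7 8 9 < 0 := by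
    have h := en 9 6 7 8 9 3 1 (by decide) (by linarith [s4 6 7 8 9 3, s3 6 7 8 3 9, s2 6 7 3 8 9, s1 6 3 7 8 9, h36789])
    linarith [s4 6 7 8 9 1, s3 6 7 8 1 9, s2 6 7 1 8 9, s1 6 1 7 8 9, h]
  have h46789 : D 4 6 7 8 9 < 0 := by
    have h := en 9 6 7 8 9 3 4 (by decide) (by linarith [s4 6 7 8 9 3, s3 6 7 8 3 9, s2 6 7 3 8 9, s1 6 3 7 8 9, h36789])
    linarith [s4 6 7 8 9 4, s3 6 7 8 4 9, s2 6 7 4 8 9, s1 6 4 7 8 9, h]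
  have h25789 : 0 < D 2 5 7 8 9 := by
    have h := en 9 2 7 8 9 3 5 (by decide) (by linarith [s4 2 7 8 9 3, s3 2 7 8 3 9, s2 2 7 3 8 9, h23789])
    linarith [s4 2 7 8 9 5, s3 2 7 8 5 9, s2 2 7 5 8 9, h]
  have h34678 : D 3 4 6 7 8 < 0 := by
    have h := en 5 3 4 7 8 9 6 (by decide) (by linarith [h34789])
    linarith [s4 3 4 7 8 6, s3 3 4 7 6 8, h]
  have h01679 : 0 < D 0 1 6 7 9 := by
    have h := ep 6 1 6 7 9 8 0 (by decide) (by linarith [s4 1 6 7 9 8, h16789])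
    linarith [s4 1 6 7 9 0, s3 1 6 7 0 9, s2 1 6 0 7 9, s1 1 0 6 7 9, h]
  have h14679 : D 1 4 6 7 9 < 0 := by
    have h := ep 6 1 6 7 9 0 4 (by decide) (by linarith [s4 1 6 7 9 0, s3 1 6 7 0 9, s2 1 6 0 7 9, s1 1 0 6 7 9, h01679])
    linarith [s4 1 6 7 9 4, s3 1 6 7 4 9, s2 1 6 4 7 9, h]
  have h04679 : 0 < D 0 4 6 7 9 := by
    have h := en 9 0 6 7 9 1 4 (by decide) (by linarith [s4 0 6 7 9 1, s3 0 6 7 1 9, s2 0 6 1 7 9, h01679])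
    linarith [s4 0 6 7 9 4, s3 0 6 7 4 9, s2 0 6 4 7 9, h]
  have h0679a : D 0 6 7 9 10 < 0 := by
    have h := en 9 0 6 7 9 1 10 (by decide) (by linarith [s4 0 6 7 9 1, s3 0 6 7 1 9, s2 0 6 1 7 9, h01679])
    linarith [h]
  have h05679 : 0 < D 0 5 6 7 9 := by
    have h := en 9 0 6 7 9 10 5 (by decide) (by linarith [h0679a])
    linarith [s4 0 6 7 9 5, s3 0 6 7 5 9, s2 0 6 5 7 9, h]
  have h0567a : D 0 5 6 7 10 < 0 := by
    have h := ep 2 0 6 7 10 9 5 (by decide) (by linarith [s4 0 6 7 10 9, h0679a])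
    linarith [s4 0 6 7 10 5, s3 0 6 7 5 10, s2 0 6 5 7 10, h]
  have h0456a : D 0 4 5 6 10 < 0 := by
    have h := ep 4 0 5 6 10 7 4 (by decide) (by linarith [s4 0 5 6 10 7, h0567a])
    linarith [s4 0 5 6 10 4, s3 0 5 6 4 10, s2 0 5 4 6 10, h]
  have h0569a : D 0 5 6 9 10 < 0 := by
    have h := ep 4 0 5 6 10 4 9 (by decide) (by linarith [s4 0 5 6 10 4, s3 0 5 6 4 10, s2 0 5 4 6 10, h0456a])
    linarith [s4 0 5 6 10 9, h]
  have h1469a : 0 < D 1 4 6 9 10 := by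
    have h := ep 0 1 4 6 9 7 10 (by decide) (by linarith [s4 1 4 6 9 7, h14679])
    linarith [h]
  have h01469 : 0 < D 0 1 4 6 9 := by
    have h := ep 0 1 4 6 9 10 0 (by decide) (by linarith [h1469a])
    linarith [s4 1 4 6 9 0, s3 1 4 6 0 9, s2 1 4 0 6 9, s1 1 0 4 6 9, h]
  have h14569 : 0 < D 1 4 5 6 9 := by
    have h := ep 0 1 4 6 9 10 5 (by decide) (by linarith [h1469a])
    linarith [s4 1 4 6 9 5, s3 1 4 6 5 9, h]
  have h26789 : D 2 6 7 8 9 = 0 := ez 9 2 6 7 8 9 (by decide)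
  have h3567a : D 3 5 6 7 10 = 0 := ez 8 3 5 6 7 10 (by decide)
  have h05678 : D 0 5 6 7 8 = 0 := by
    have h := ee 9 0 6 7 8 5 10 (by decide) (ez 2 0 6 7 8 10 (by decide))
    linarith [s1 0 5 6 7 8, s2 0 5 6 7 8, s3 0 6 5 7 8, s4 0 6 7 5 8]
  have g7 := gp 7 8 9 2 3 5 6
  simp only [s3 7 8 9 2 3, s4 7 8 2 9 3, s2 7 8 2 3 9, s3 7 2 8 3 9, s1 7 2 3 8 9, s2 2 7 3 8 9, s3 7 8 9 5 6, s4 7 8 5 9 6, s2 7 8 5 6 9, s3 7 5 8 6 9, s1 7 5 6 8 9, s2 5 7 6 8 9, s3 7 8 9 2 5, s4 7 8 2 9 5, s2 7 8 2 5 9, s3 7 2 8 5 9, s1 7 2 5 8 9, s2 2 7 5 8 9, s3 7 8 9 3 6, s4 7 8 3 9 6, s2 7 8 3 6 9, s3 7 3 8 6 9, s1 7 3 6 8 9, s2 3 7 6 8 9, s3 7 8 9 2 6, s4 7 8 2 9 6, s2 7 8 2 6 9, s3 7 2 8 6 9, s1 7 2 6 8 9, s2 2 7 6 8 9, s3 7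 8 9 3 5, s4 7 8 3 9 5, s2 7 8 3 5 9, s3 7 3 8 5 9, s1 7 3 5 8 9, s2 3 7 5 8 9] at g7
  have h56789 : D 5 6 7 8 9 < 0 := by
    by_contra hc
    push Not at hc
    rw [h26789] at g7
    linarith [mul_nonneg h23789.le hc, mul_pos h25789 (neg_pos.2 h36789)]
  have h5679a : 0 < D 5 6 7 9 10 := by
    have h := ep 6 5 6 7 9 8 10 (by decide) (by linarith [s4 5 6 7 9 8, h56789])
    linarith [h]
  have h35679 : 0 < D 3 5 6 7 9 := by
    have h := ep 6 5 6 7 9 10 3 (by decide) (by linarith [h5679a])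
    linarith [s4 5 6 7 9 3, s3 5 6 7 3 9, s2 5 6 3 7 9, s1 5 3 6 7 9, h]
  have h45679 : 0 < D 4 5 6 7 9 := by
    have h := ep 6 5 6 7 9 10 4 (by decide) (by linarith [h5679a])
    linarith [s4 5 6 7 9 4, s3 5 6 7 4 9, s2 5 6 4 7 9, s1 5 4 6 7 9, h]
  have h2567a : D 2 5 6 7 10 < 0 := by
    have h := en 8 5 6 7 10 9 2 (by decide) (by linarith [s4 5 6 7 10 9, h5679a])
    linarith [s4 5 6 7 10 2, s3 5 6 7 2 10, s2 5 6 2 7 10, s1 5 2 6 7 10, h]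
  have g6 := gp 4 6 9 0 1 5 7
  simp only [s3 4 6 9 0 1, s4 4 6 0 9 1, s2 4 6 0 1 9, s3 4 0 6 1 9, s1 4 0 1 6 9, s2 0 4 1 6 9, s3 4 6 9 5 7, s4 4 6 5 9 7, s2 4 6 5 7 9, s3 4 6 9 0 5, s4 4 6 0 9 5, s2 4 6 0 5 9, s3 4 0 6 5 9, s1 4 0 5 6 9, s3 4 6 9 1 7, s4 4 6 1 9 7, s2 4 6 1 7 9, s1 4 1 6 7 9, s3 4 6 9 0 7, s4 4 6 0 9 7, s2 4 6 0 7 9, s1 4 0 6 7 9, s3 4 6 9 1 5, s4 4 6 1 9 5, s2 4 6 1 5 9, s3 4 1 6 5 9, s1 4 1 5 6 9] at g6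
  have h04569 : D 0 4 5 6 9 < 0 := by
    by_contra hc
    push Not at hc
    linarith [mul_pos h01469 h45679, mul_pos h04679 h14569, mul_nonneg hc (neg_pos.2 h14679).le]
  have g1 := gp 0 5 6 4 7 9 10
  simp only [s3 0 5 6 4 7, s2 0 5 4 6 7, s3 0 5 6 4 9, s2 0 5 4 6 9, s3 0 5 6 4 10, s2 0 5 4 6 10] at g1
  have h04567 : D 0 4 5 6 7 < 0 := by
    by_contra hc
    push Not at hc
    linarith [mul_pos (neg_pos.2 h04569) (neg_pos.2 h0567a), mul_pos (neg_pos.2 h0456a) h05679, mul_nonneg hc (neg_pos.2 h0569a).le]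
  have g4 := gp 5 6 7 2 3 9 10
  simp only [s3 5 6 7 2 3, s4 5 6 2 7 3, s2 5 6 2 3 7, s3 5 2 6 3 7, s1 5 2 3 6 7, s2 2 5 3 6 7, s3 5 6 7 2 9, s2 5 6 2 7 9, s1 5 2 6 7 9, s3 5 6 7 3 10, s2 5 6 3 7 10, s1 5 3 6 7 10, s3 5 6 7 2 10, s2 5 6 2 7 10, s1 5 2 6 7 10, s3 5 6 7 3 9, s2 5 6 3 7 9, s1 5 3 6 7 9] at g4
  have h23567 : 0 < D 2 3 5 6 7 := by
    by_contra hc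
    push Not at hc
    rw [h3567a] at g4
    linarith [mul_pos (neg_pos.2 h2567a) h35679, mul_nonneg (neg_nonneg.2 hc) h5679a.le]
  have h35678 : 0 < D 3 5 6 7 8 := by
    have h := ep 8 3 5 6 7 2 8 (by decide) (by linarith [s4 3 5 6 7 2, s3 3 5 6 2 7, s2 3 5 2 6 7, s1 3 2 5 6 7, h23567])
    linarith [h]
  have g3 := gp 5 6 7 0 2 3 10
  simp only [s3 5 6 7 0 2, s4 5 6 0 7 2, s2 5 6 0 2 7, s3 5 0 6 2 7, s1 5 0 2 6 7, s2 0 5 2 6 7, s3 5 6 7 3 10, s2 5 6 3 7 10, s1 5 3 6 7 10, s3 5 6 7 0 3, s4 5 6 0 7 3, s2 5 6 0 3 7, s3 5 0 6 3 7, s1 5 0 3 6 7, s2 0 5 3 6 7, s3 5 6 7 2 10, s2 5 6 2 7 10, s1 5 2 6 7 10, s3 5 6 7 0 10, s2 5 6 0 7 10, s1 5 0 6 7 10, s3 5 6 7 2 3, s4 5 6 2 7 3, s2 5 6 2 3 7, s3 5 2 6 3 7, s1 5 2 3 6 7, s2 2 5 3 6 7] at g3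
  have h03567 : 0 < D 0 3 5 6 7 := by
    by_contra hc
    push Not at hc
    rw [h3567a] at g3
    linarith [mul_pos (neg_pos.2 h0567a) h23567, mul_nonneg (neg_nonneg.2 hc) (neg_pos.2 h2567a).le]
  have g2 := gp 5 6 7 0 3 4 8
  simp only [s3 5 6 7 0 3, s4 5 6 0 7 3, s2 5 6 0 3 7, s3 5 0 6 3 7, s1 5 0 3 6 7, s2 0 5 3 6 7, s3 5 6 7 4 8, s2 5 6 4 7 8, s1 5 4 6 7 8, s3 5 6 7 0 4, s4 5 6 0 7 4, s2 5 6 0 4 7, s3 5 0 6 4 7, s1 5 0 4 6 7, s2 0 5 4 6 7, s3 5 6 7 3 8, s2 5 6 3 7 8, s1 5 3 6 7 8, s3 5 6 7 0 8, s2 5 6 0 7 8, s1 5 0 6 7 8, s3 5 6 7 3 4, s4 5 6 3 7 4, s2 5 6 3 4 7, s3 5 3 6 4 7, s1 5 3 4 6 7, s2 3 5 4 6 7] at g2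
  have h45678 : D 4 5 6 7 8 < 0 := by
    by_contra hc
    push Not at hc
    rw [h05678] at g2
    linarith [mul_pos (neg_pos.2 h04567) h35678, mul_nonneg hc h03567.le]
  have g5 := gp 6 7 8 3 4 5 9
  simp only [s3 6 7 8 3 4, s4 6 7 3 8 4, s2 6 7 3 4 8, s3 6 3 7 4 8, s1 6 3 4 7 8, s2 3 6 4 7 8, s3 6 7 8 5 9, s2 6 7 5 8 9, s1 6 5 7 8 9, s3 6 7 8 3 5, s4 6 7 3 8 5, s2 6 7 3 5 8, s3 6 3 7 5 8, s1 6 3 5 7 8, s2 3 6 5 7 8, s3 6 7 8 4 9, s2 6 7 4 8 9, s1 6 4 7 8 9, s3 6 7 8 3 9, s2 6 7 3 8 9, s1 6 3 7 8 9, s3 6 7 8 4 5, s4 6 7 4 8 5, s2 6 7 4 5 8, s3 6 4 7 5 8, s1 6 4 5 7 8, s2 4 6 5 7 8] at g5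
  linarith [mul_pos (neg_pos.2 h34678) (neg_pos.2 h56789), mul_pos h35678 (neg_pos.2 h46789), mul_pos (neg_pos.2 h36789) (neg_pos.2 h45678)]

open scoped Matrix

/-- The 3-sphere `(11⁰₃₅)` has no polytopal realization. -/
theorem sphere_11_35_35_11_a_not_polytopal :
    ¬ ∃ v : Fin 11 → EuclideanSpace ℝ (Fin 4),
      Function.Injective v ∧
      (∀ j, v j ∈ convexHull ℝ (Set.range v) ∧
        v j ∉ convexHull ℝ (convexHull ℝ (Set.range v) \ {v j})) ∧
      {F : Set (EuclideanSpace ℝ (Fin 4)) |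
          F ≠ ∅ ∧ F ≠ convexHull ℝ (Set.range v) ∧
          IsExposed ℝ (convexHull ℝ (Set.range v)) F ∧
          finrank ℝ (vectorSpan ℝ F) = 3} =
        Set.range (fun i : Fin 11 => convexHull ℝ (v '' facets i)) := by
  rintro ⟨v, hinj, hext, hF⟩
  have H : ∀ i, ∃ φ : Fin 5 → ℝ, ∀ j,
      (j ∈ FF i → (Fin.cons 1 (fun k => v j k) : Fin 5 → ℝ) ⬝ᵥ φ = 0) ∧
      (j ∉ FF i → 0 < (Fin.cons 1 (fun k => v j k) : Fin 5 → ℝ) ⬝ᵥ φ) := by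
    intro i
    have hi : convexHull ℝ (v '' facets i) ∈
        Set.range (fun i : Fin 11 => convexHull ℝ (v '' facets i)) := ⟨i, rfl⟩
    rw [← hF] at hi
    obtain ⟨hne, -, hexp, -⟩ := hi
    obtain ⟨w, hw⟩ := Set.nonempty_iff_ne_empty.2 hne
    obtain ⟨l, hl⟩ := hexp ⟨w, hw⟩
    have hw' := hw
    rw [hl] at hw'
    let a := (InnerProductSpace.toDual ℝ (EuclideanSpace ℝ (Fin 4))).symm l
    have ha : ∀ u : EuclideanSpace ℝ (Fin 4), l u = ∑ k, u k * a k := by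
      intro u
      rw [← InnerProductSpace.toDual_symm_apply (𝕜 := ℝ) (y := l) (x := u), PiLp.inner_apply]
      simp [a]
    refine ⟨Fin.cons (l w) (fun k => - a k), fun j => ?_⟩
    have hval : (Fin.cons 1 (fun k => v j k) : Fin 5 → ℝ) ⬝ᵥ
        (Fin.cons (l w) (fun k => - a k)) = l w - l (v j) := by
      rw [ha (v j)]
      simp [dotProduct, Fin.sum_univ_succ]
      ring
    rw [hval]
    constructor
    · intro hj
      have hm : v j ∈ convexHull ℝ (v '' facets i) :=
        subset_convexHull ℝ _ ⟨j, (mem_FF i j).2 hj, rfl⟩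
      rw [hl] at hm
      linarith [hm.2 w hw'.1, hw'.2 (v j) hm.1]
    · intro hj
      by_contra hc
      have hm : v j ∈ convexHull ℝ (v '' facets i) := by
        rw [hl]
        refine ⟨(hext j).1, fun y hy => ?_⟩
        linarith [hw'.2 y hy]
      refine (hext j).2 (convexHull_mono ?_ hm)
      rintro _ ⟨p, hp, rfl⟩
      refine ⟨(hext p).1, fun hpj => ?_⟩
      exact hj ((mem_FF i j).1 (hinj hpj ▸ hp))
  choose φ hφ using H
  exact key (fun j => Fin.cons 1 (fun k => v j k)) φ (fun i j => (hφ i j).1) (fun i j => (hφ i j).2)
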